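/- If f(m,n), g(m,n), and h(m,n) are polynomials in ℚ[m,n] each of which can be written as a finite sum Σ α_{k,l}·C(m,k)·C(n,l) with all coefficients α_{k,l} nonnegative integers, then the composed polynomial (m,n) ↦ f(g(m,n), h(m,n)) can also be written as a finite sum Σ β_{k,l}·C(m,k)·C(n,l) with all coefficients β_{k,l} nonnegative integers. -/

import Mathlib

/-- The one-variable binomial coefficient polynomial
`C(X,k) = X(X-1)⋯(X-k+1)/k! ∈ ℚ[X]`. -/
noncomputable def binPoly (k : ℕ) : Polynomial ℚ :=
  Polynomial.C ((k.factorial : ℚ)⁻¹) * descPochhammer ℚ k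

/-- The two-variable polynomial `C(m,k)·C(n,l) ∈ ℚ[m,n]`. -/
noncomputable def binMv (k l : ℕ) : MvPolynomial (Fin 2) ℚ :=
  Polynomial.aeval (MvPolynomial.X 0) (binPoly k) *
    Polynomial.aeval (MvPolynomial.X 1) (binPoly l)

lemma Nat.add_choose_eq_add_sum (a b k : ℕ) :
    (a + b).choose k = a.choose k + ∑ i ∈ Finset.range k, a.choose i * b.choose (k - i) := by
  rw [Nat.add_choose_eq, Finset.Nat.sum_antidiagonal_eq_sum_range_succ_mk,
    Finset.sum_range_succ]
  simp [add_comm]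

lemma Nat.sum_range_choose_right (k m : ℕ) :
    ∑ i ∈ Finset.range m, i.choose k = m.choose (k + 1) := by
  induction m with
  | zero => simp
  | succ m ih => rw [Finset.sum_range_succ, ih, Nat.choose_succ_succ, add_comm]

/-- Functions `ℕ² → ℕ` all of whose iterated forward differences are nonnegative, and vanish
after finitely many steps. -/
inductive HasNonnegDiffs : (ℕ → ℕ → ℕ) → Prop
  | zero : HasNonnegDiffs 0
  | step (F D E : ℕ → ℕ → ℕ) (hD : HasNonnegDiffs D) (hE : HasNonnegDiffs E)
      (hm : ∀ m n, F (m + 1) n = F m n + D m n)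
      (hn : ∀ m n, F m (n + 1) = F m n + E m n) : HasNonnegDiffs F

namespace HasNonnegDiffs

variable {F G : ℕ → ℕ → ℕ}

lemma const (c : ℕ) : HasNonnegDiffs (fun _ _ => c) :=
  step _ 0 0 zero zero (by simp) (by simp)

lemma add (hF : HasNonnegDiffs F) (hG : HasNonnegDiffs G) : HasNonnegDiffs (F + G) := by
  induction hF generalizing G with
  | zero => simpa using hG
  | step F D E hD hE hm hn ihD ihE =>
    cases hG with
    | zero => simpa using step F D E hD hE hm hn
    | step _ D' E' hD' hE' hm' hn' =>
      refine step _ _ _ (ihD hD') (ihE hE') (fun m n => ?_) (fun m n => ?_)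
      · simp only [Pi.add_apply, hm, hm']; ring
      · simp only [Pi.add_apply, hn, hn']; ring

lemma sum {ι : Type*} (s : Finset ι) {F : ι → ℕ → ℕ → ℕ}
    (h : ∀ i ∈ s, HasNonnegDiffs (F i)) : HasNonnegDiffs (∑ i ∈ s, F i) :=
  Finset.sum_induction F HasNonnegDiffs (fun _ _ => add) zero h

lemma mul (hF : HasNonnegDiffs F) (hG : HasNonnegDiffs G) : HasNonnegDiffs (F * G) := by
  induction hF generalizing G with
  | zero => simpa using zero
  | step F D E hD hE hm hn ihD ihE =>
    induction hG with
    | zero => simpa using zero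
    | step G D' E' hD' hE' hm' hn' ihD' ihE' =>
      refine step _ (F * D' + D * G + D * D') (F * E' + E * G + E * E')
        ((ihD'.add (ihD (step G D' E' hD' hE' hm' hn'))).add (ihD hD'))
        ((ihE'.add (ihE (step G D' E' hD' hE' hm' hn'))).add (ihE hE'))
        (fun m n => ?_) (fun m n => ?_)
      · simp only [Pi.add_apply, Pi.mul_apply, hm, hm']; ring
      · simp only [Pi.add_apply, Pi.mul_apply, hn, hn']; ring

lemma choose (hF : HasNonnegDiffs F) (k : ℕ) :
    HasNonnegDiffs (fun m n => (F m n).choose k) := by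
  induction hF generalizing k with
  | zero => exact const (Nat.choose 0 k)
  | step F D E hD hE hm hn ihD ihE =>
    induction k using Nat.strong_induction_on with
    | _ k ih =>
      refine step _
        (∑ i ∈ Finset.range k, (fun m n => (F m n).choose i) * fun m n => (D m n).choose (k - i))
        (∑ i ∈ Finset.range k, (fun m n => (F m n).choose i) * fun m n => (E m n).choose (k - i))
        (sum _ fun i hi => (ih i (Finset.mem_range.1 hi)).mul (ihD _))
        (sum _ fun i hi => (ih i (Finset.mem_range.1 hi)).mul (ihE _))
        (fun m n => ?_) (fun m n => ?_)
      · simp [hm, Nat.add_choose_eq_add_sum, Finset.sum_apply]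
      · simp [hn, Nat.add_choose_eq_add_sum, Finset.sum_apply]

lemma fst : HasNonnegDiffs (fun m _ => m) :=
  step _ (fun _ _ => 1) 0 (const 1) zero (by simp) (by simp)

lemma snd : HasNonnegDiffs (fun _ n => n) :=
  step _ 0 (fun _ _ => 1) zero (const 1) (by simp) (by simp)

lemma sum_choose_mul_choose (N : ℕ) (α : ℕ → ℕ → ℕ) (hF : HasNonnegDiffs F)
    (hG : HasNonnegDiffs G) :
    HasNonnegDiffs (fun m n => ∑ k ∈ Finset.range N, ∑ l ∈ Finset.range N,
      α k l * ((F m n).choose k * (G m n).choose l)) := by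
  have key := sum (Finset.range N) fun k _ => sum (Finset.range N) fun l _ =>
    (const (α k l)).mul ((hF.choose k).mul (hG.choose l))
  convert key using 3
  simp [Finset.sum_apply]

/-- The functions `(m, n) ↦ C(m,k)·C(n,l)`. -/
def chooseMulChoose (p : ℕ × ℕ) : ℕ → ℕ → ℕ := fun m n => m.choose p.1 * n.choose p.2

open Submodule in
lemma sum_fst_mem_span {D : ℕ → ℕ → ℕ} (hD : D ∈ span ℕ (Set.range chooseMulChoose)) :
    (fun m n => ∑ i ∈ Finset.range m, D i n) ∈ span ℕ (Set.range chooseMulChoose) := by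
  induction hD using span_induction with
  | mem x hx =>
    obtain ⟨⟨k, l⟩, rfl⟩ := hx
    refine subset_span ⟨(k + 1, l), ?_⟩
    funext m n
    simp [chooseMulChoose, ← Finset.sum_mul, Nat.sum_range_choose_right]
  | zero =>
    convert zero_mem (span ℕ (Set.range chooseMulChoose)) using 1
    funext m n
    simp
  | add x y _ _ hx hy =>
    convert add_mem hx hy using 1
    funext m n
    simp [Finset.sum_add_distrib]
  | smul a x _ hx =>
    convert smul_mem _ a hx using 1
    funext m n
    simp [Finset.mul_sum]

open Submodule in
lemma sum_snd_zero_mem_span {E : ℕ → ℕ → ℕ} (hE : E ∈ span ℕ (Set.range chooseMulChoose)) :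
    (fun _ n => ∑ j ∈ Finset.range n, E 0 j) ∈ span ℕ (Set.range chooseMulChoose) := by
  induction hE using span_induction with
  | mem x hx =>
    obtain ⟨⟨k, l⟩, rfl⟩ := hx
    have key := smul_mem (span ℕ (Set.range chooseMulChoose)) (Nat.choose 0 k)
      (subset_span ⟨(0, l + 1), rfl⟩)
    convert key using 1
    funext m n
    simp [chooseMulChoose, ← Finset.mul_sum, Nat.sum_range_choose_right]
  | zero =>
    convert zero_mem (span ℕ (Set.range chooseMulChoose)) using 1
    funext m n
    simp
  | add x y _ _ hx hy =>
    convert add_mem hx hy using 1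
    funext m n
    simp [Finset.sum_add_distrib]
  | smul a x _ hx =>
    convert smul_mem _ a hx using 1
    funext m n
    simp [Finset.mul_sum]

open Submodule in
lemma mem_span (hF : HasNonnegDiffs F) : F ∈ span ℕ (Set.range chooseMulChoose) := by
  induction hF with
  | zero => exact zero_mem _
  | step F D E _ _ hm hn ihD ihE =>
    have h₀ := smul_mem (span ℕ (Set.range chooseMulChoose)) (F 0 0)
      (subset_span ⟨(0, 0), rfl⟩)
    convert add_mem (add_mem h₀ (sum_snd_zero_mem_span ihE)) (sum_fst_mem_span ihD) using 1
    have h₁ (n : ℕ) : F 0 n = F 0 0 + ∑ j ∈ Finset.range n, E 0 j := by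
      induction n with
      | zero => simp
      | succ n ih => rw [hn, ih, Finset.sum_range_succ, add_assoc]
    have h₂ (m n : ℕ) : F m n = F 0 n + ∑ i ∈ Finset.range m, D i n := by
      induction m with
      | zero => simp
      | succ m ih => rw [hm, ih, Finset.sum_range_succ, add_assoc]
    funext m n
    rw [h₂, h₁]
    simp [chooseMulChoose]

lemma exists_eq_sum_choose (hF : HasNonnegDiffs F) :
    ∃ (N : ℕ) (γ : ℕ → ℕ → ℕ), ∀ m n, F m n =
      ∑ k ∈ Finset.range N, ∑ l ∈ Finset.range N, γ k l * (m.choose k * n.choose l) := by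
  obtain ⟨c, rfl⟩ := Finsupp.mem_span_range_iff_exists_finsupp.1 hF.mem_span
  set N := c.support.sup (fun p => max p.1 p.2) + 1
  have hN : c.support ⊆ Finset.range N ×ˢ Finset.range N := fun p hp => by
    have := Finset.le_sup (f := fun p : ℕ × ℕ => max p.1 p.2) hp
    simp only [Finset.mem_product, Finset.mem_range]
    omega
  refine ⟨N, fun k l => c (k, l), fun m n => ?_⟩
  rw [← Finset.sum_product', Finsupp.sum_of_support_subset c hN _ (by simp)]
  simp [Finset.sum_apply, chooseMulChoose]

end HasNonnegDiffs

lemma eval_binPoly_natCast (k m : ℕ) : (binPoly k).eval (m : ℚ) = (m.choose k : ℚ) := by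
  rw [binPoly, Polynomial.eval_mul, Polynomial.eval_C, descPochhammer_eval_eq_descFactorial,
    Nat.descFactorial_eq_factorial_mul_choose, Nat.cast_mul,
    inv_mul_cancel_left₀ (Nat.cast_ne_zero.2 k.factorial_ne_zero)]

lemma eval_binMv_natCast (k l m n : ℕ) :
    MvPolynomial.eval ![(m : ℚ), (n : ℚ)] (binMv k l) = (m.choose k * n.choose l : ℕ) := by
  simp only [binMv, map_mul, ← MvPolynomial.coe_aeval_eq_eval, RingHom.coe_coe,
    ← Polynomial.aeval_algHom_apply, MvPolynomial.aeval_X]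
  simp [Polynomial.coe_aeval_eq_eval, eval_binPoly_natCast]

lemma eval_sum_binMv_natCast (N : ℕ) (α : ℕ → ℕ → ℕ) (m n : ℕ) :
    MvPolynomial.eval ![(m : ℚ), (n : ℚ)] (∑ k ∈ Finset.range N, ∑ l ∈ Finset.range N,
        MvPolynomial.C (α k l : ℚ) * binMv k l) =
      (∑ k ∈ Finset.range N, ∑ l ∈ Finset.range N, α k l * (m.choose k * n.choose l) : ℕ) := by
  simp [eval_binMv_natCast]

/-- Bivariate polynomials that agree on `ℕ²` are equal. -/
lemma MvPolynomial.eq_of_eval_natCast_eq {p q : MvPolynomial (Fin 2) ℚ}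
    (h : ∀ m n : ℕ, MvPolynomial.eval ![(m : ℚ), (n : ℚ)] p =
      MvPolynomial.eval ![(m : ℚ), (n : ℚ)] q) : p = q := by
  refine MvPolynomial.funext_set (fun _ => Set.range ((↑) : ℕ → ℚ))
    (fun _ => Set.infinite_range_of_injective Nat.cast_injective) fun x hx => ?_
  obtain ⟨m, hm⟩ := hx 0 (Set.mem_univ _)
  obtain ⟨n, hn⟩ := hx 1 (Set.mem_univ _)
  have hx' : x = ![(m : ℚ), (n : ℚ)] := by
    funext i
    fin_cases i
    · exact hm.symm
    · exact hn.symm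
  rw [hx']
  exact h m n

/-- If `f`, `g`, `h` can each be written as finite sums `Σ α_{k,l}·C(m,k)·C(n,l)` with
nonnegative integer coefficients, then so can the composition `f(g(m,n), h(m,n))`. -/
theorem nonneg_PBC_comp (f g h : MvPolynomial (Fin 2) ℚ)
    (hf : ∃ (N : ℕ) (α : ℕ → ℕ → ℕ),
      f = ∑ k ∈ Finset.range N, ∑ l ∈ Finset.range N,
        MvPolynomial.C ((α k l : ℚ)) * binMv k l)
    (hg : ∃ (N : ℕ) (β : ℕ → ℕ → ℕ),
      g = ∑ k ∈ Finset.range N, ∑ l ∈ Finset.range N,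
        MvPolynomial.C ((β k l : ℚ)) * binMv k l)
    (hh : ∃ (N : ℕ) (δ : ℕ → ℕ → ℕ),
      h = ∑ k ∈ Finset.range N, ∑ l ∈ Finset.range N,
        MvPolynomial.C ((δ k l : ℚ)) * binMv k l) :
    ∃ (N : ℕ) (γ : ℕ → ℕ → ℕ),
      MvPolynomial.aeval ![g, h] f = ∑ k ∈ Finset.range N, ∑ l ∈ Finset.range N,
        MvPolynomial.C ((γ k l : ℚ)) * binMv k l := by
  obtain ⟨N, α, rfl⟩ := hf
  obtain ⟨N₁, β, rfl⟩ := hg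
  obtain ⟨N₂, δ, rfl⟩ := hh
  open HasNonnegDiffs in
  obtain ⟨M, γ, hγ⟩ := (sum_choose_mul_choose N α (sum_choose_mul_choose N₁ β fst snd)
    (sum_choose_mul_choose N₂ δ fst snd)).exists_eq_sum_choose
  refine ⟨M, γ, MvPolynomial.eq_of_eval_natCast_eq fun m n => ?_⟩
  rw [eval_sum_binMv_natCast, ← hγ, ← eval_sum_binMv_natCast, ← MvPolynomial.coe_aeval_eq_eval,
    RingHom.coe_coe, MvPolynomial.comp_aeval_apply, ← MvPolynomial.coe_aeval_eq_eval,
    RingHom.coe_coe]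
  congr 2
  funext i
  fin_cases i
  · exact eval_sum_binMv_natCast N₁ β m n
  · exact eval_sum_binMv_natCast N₂ δ m n
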